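/- The function B ↦ sup_{0≤α≤1} (1/2)·log( (α + (1−α)B) / B^(1−α) ) is monotone nondecreasing on [1, ∞): for all 1 ≤ B₁ ≤ B₂, sup_{0≤α≤1} (1/2)·log((α + (1−α)B₁)/B₁^(1−α)) ≤ sup_{0≤α≤1} (1/2)·log((α + (1−α)B₂)/B₂^(1−α)). -/

import Mathlib

open Real

/-- For fixed `α ∈ [0, 1]`, the ratio of the weighted arithmetic mean to the weighted geometric
mean of `1` and `B` is nondecreasing in `B ≥ 1`. -/
lemma weighted_mean_ratio_mono {α B₁ B₂ : ℝ} (hα : α ∈ Set.Icc (0 : ℝ) 1)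
    (h1 : 1 ≤ B₁) (h12 : B₁ ≤ B₂) :
    (α + (1 - α) * B₁) / B₁ ^ (1 - α) ≤ (α + (1 - α) * B₂) / B₂ ^ (1 - α) := by
  obtain ⟨h0, h1'⟩ := hα
  have hB₁ : 0 < B₁ := by linarith
  obtain ⟨r, rfl⟩ : ∃ r, B₂ = B₁ * r := ⟨B₂ / B₁, by field_simp⟩
  have hr : 1 ≤ r := by nlinarith
  have bernoulli : r ^ (1 - α) ≤ 1 + (1 - α) * (r - 1) := by
    simpa using rpow_one_add_le_one_add_mul_self (s := r - 1) (p := 1 - α)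
      (by linarith) (by linarith) (by linarith)
  have hgap : 0 ≤ α * (1 - α) * ((B₁ - 1) * (r - 1)) :=
    mul_nonneg (mul_nonneg h0 (sub_nonneg.2 h1'))
      (mul_nonneg (sub_nonneg.2 h1) (sub_nonneg.2 hr))
  have hmean : 0 ≤ α + (1 - α) * B₁ :=
    add_nonneg h0 (mul_nonneg (sub_nonneg.2 h1') hB₁.le)
  have hpow : 0 < B₁ ^ (1 - α) := rpow_pos_of_pos hB₁ _
  have hrpow : 0 < r ^ (1 - α) := rpow_pos_of_pos (by linarith) _
  rw [mul_rpow hB₁.le (by linarith), div_le_div_iff₀ hpow (mul_pos hpow hrpow)]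
  calc (α + (1 - α) * B₁) * (B₁ ^ (1 - α) * r ^ (1 - α))
      = (α + (1 - α) * B₁) * r ^ (1 - α) * B₁ ^ (1 - α) := by ring
    _ ≤ (α + (1 - α) * B₁) * (1 + (1 - α) * (r - 1)) * B₁ ^ (1 - α) := by gcongr
    _ ≤ (α + (1 - α) * (B₁ * r)) * B₁ ^ (1 - α) := by
      gcongr
      linarith

lemma weighted_mean_pos {α B : ℝ} (hα : α ∈ Set.Icc (0 : ℝ) 1) (hB : 1 ≤ B) :
    0 < α + (1 - α) * B := by
  nlinarith [hα.1, hα.2]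

lemma weighted_mean_ratio_pos {α B : ℝ} (hα : α ∈ Set.Icc (0 : ℝ) 1) (hB : 1 ≤ B) :
    0 < (α + (1 - α) * B) / B ^ (1 - α) :=
  div_pos (weighted_mean_pos hα hB) (rpow_pos_of_pos (by linarith) _)

lemma weighted_mean_ratio_le {α B : ℝ} (hα : α ∈ Set.Icc (0 : ℝ) 1) (hB : 1 ≤ B) :
    (α + (1 - α) * B) / B ^ (1 - α) ≤ B :=
  (div_le_self (weighted_mean_pos hα hB).le (one_le_rpow hB (sub_nonneg.2 hα.2))).trans
    (by nlinarith [hα.1])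

theorem chernoff_information_monotone_in_variance_ratio
    (B₁ B₂ : ℝ) (h1 : 1 ≤ B₁) (h12 : B₁ ≤ B₂) :
    sSup {x : ℝ | ∃ α ∈ Set.Icc (0 : ℝ) 1,
        x = (1 / 2) * Real.log ((α + (1 - α) * B₁) / B₁ ^ (1 - α))}
      ≤ sSup {x : ℝ | ∃ α ∈ Set.Icc (0 : ℝ) 1,
        x = (1 / 2) * Real.log ((α + (1 - α) * B₂) / B₂ ^ (1 - α))} := by
  have h2 : 1 ≤ B₂ := h1.trans h12
  refine csSup_le ⟨_, 0, by simp, rfl⟩ ?_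
  rintro _ ⟨α, hα, rfl⟩
  have hbdd : BddAbove {x : ℝ | ∃ α ∈ Set.Icc (0 : ℝ) 1,
      x = (1 / 2) * Real.log ((α + (1 - α) * B₂) / B₂ ^ (1 - α))} := by
    refine ⟨(1 / 2) * Real.log B₂, ?_⟩
    rintro _ ⟨β, hβ, rfl⟩
    exact mul_le_mul_of_nonneg_left
      (log_le_log (weighted_mean_ratio_pos hβ h2) (weighted_mean_ratio_le hβ h2)) (by norm_num)
  refine le_trans ?_ (le_csSup hbdd ⟨α, hα, rfl⟩)
  exact mul_le_mul_of_nonneg_left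
    (log_le_log (weighted_mean_ratio_pos hα h1) (weighted_mean_ratio_mono hα h1 h12))
    (by norm_num)
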